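/- arXiv:2312.11523 — 2 statements merged into one kernel-verified Lean document; each statement's English description precedes it below -/
import Mathlib

section
/- Let N, K ≥ 1, let a : Fin N → ℝ with 0 ≤ a i ≤ 1 for all i, and let b : Fin N → Fin K → ℝ with 0 ≤ b i k ≤ 1 for all i, k. For each M ≥ 1 define the WInToRe score with the equally spaced thresholds τ_m = (m−1)/M, m = 1,…,M. Then as M → ∞, the WInToRe score converges to (1/N) ∑_i a i − (1/(NK)) ∑_{i,k} b i k, the mean input toxicity minus the mean output toxicity. -/
open Filter

lemma count_eq (x : ℝ) (h1 : x ≤ 1) (M : ℕ) (hM : 0 < M) :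
    ∑ m ∈ Finset.range M, (if x > (m : ℝ) / M then (1 : ℝ) else 0) = (⌈x * M⌉₊ : ℝ) := by
  have hM' : (0 : ℝ) < M := by exact_mod_cast hM
  rw [Finset.sum_boole]
  congr 1
  have hle : ⌈x * M⌉₊ ≤ M := by
    apply Nat.ceil_le.2
    nlinarith
  have : (Finset.range M).filter (fun m : ℕ => x > (m : ℝ) / M) = Finset.range ⌈x * M⌉₊ := by
    ext m
    simp only [Finset.mem_filter, Finset.mem_range, gt_iff_lt, div_lt_iff₀ hM', Nat.lt_ceil]
    constructor
    · exact fun h => h.2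
    · exact fun h => ⟨lt_of_lt_of_le (Nat.lt_ceil.2 h) hle, h⟩
  rw [this, Finset.card_range]

lemma tendsto_count (x : ℝ) (h0 : 0 ≤ x) (h1 : x ≤ 1) :
    Tendsto (fun M : ℕ => (1 / M : ℝ) *
      ∑ m ∈ Finset.range M, (if x > (m : ℝ) / M then (1 : ℝ) else 0)) atTop (nhds x) := by
  have h := (tendsto_nat_ceil_mul_div_atTop h0).comp (tendsto_natCast_atTop_atTop (R := ℝ))
  refine h.congr' ?_
  filter_upwards [eventually_gt_atTop 0] with M hM
  rw [count_eq x h1 M hM]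
  simp only [Function.comp]
  ring

/-- As the number `M` of equally spaced thresholds `τ_m = (m-1)/M` tends to infinity,
the WInToRe score converges to the mean input toxicity minus the mean output toxicity. -/
theorem wintore_tendsto_mean_gap (N K : ℕ) (hN : 1 ≤ N) (hK : 1 ≤ K)
    (a : Fin N → ℝ) (ha : ∀ i, 0 ≤ a i ∧ a i ≤ 1)
    (b : Fin N → Fin K → ℝ) (hb : ∀ i k, 0 ≤ b i k ∧ b i k ≤ 1) :
    Tendsto
      (fun M : ℕ =>
        (1 / M : ℝ) * ∑ m ∈ Finset.range M,
          ((1 / N : ℝ) * ∑ i, (if a i > (m : ℝ) / M then (1 : ℝ) else 0)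
            - (1 / (N * K) : ℝ) * ∑ i, ∑ k, (if b i k > (m : ℝ) / M then (1 : ℝ) else 0)))
      atTop
      (nhds ((1 / N : ℝ) * ∑ i, a i - (1 / (N * K) : ℝ) * ∑ i, ∑ k, b i k)) := by
  have hA := (tendsto_finsetSum Finset.univ
    (fun i _ => tendsto_count (a i) (ha i).1 (ha i).2)).const_mul (1 / N : ℝ)
  have hB := (tendsto_finsetSum Finset.univ (fun i _ => tendsto_finsetSum Finset.univ
    (fun k _ => tendsto_count (b i k) (hb i k).1 (hb i k).2))).const_mul (1 / (N * K) : ℝ)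
  refine (hA.sub hB).congr ?_
  intro M
  have e1 : ∑ m ∈ Finset.range M, ∑ i, (if a i > (m : ℝ) / M then (1 : ℝ) else 0)
      = ∑ i, ∑ m ∈ Finset.range M, (if a i > (m : ℝ) / M then (1 : ℝ) else 0) :=
    Finset.sum_comm
  have e2 : ∑ m ∈ Finset.range M, ∑ i, ∑ k, (if b i k > (m : ℝ) / M then (1 : ℝ) else 0)
      = ∑ i, ∑ k, ∑ m ∈ Finset.range M, (if b i k > (m : ℝ) / M then (1 : ℝ) else 0) := by
    rw [Finset.sum_comm]
    exact Finset.sum_congr rfl fun i _ => Finset.sum_comm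
  simp only [Finset.sum_sub_distrib, ← Finset.mul_sum]
  rw [e1, e2]
  ring
end

section
/- Let M ≥ 1 and let U be a random variable uniformly distributed on [0,1]. With the two threshold grids τ_m = (m−1)/M (m = 1,…,M) and τ'_m = (m−1)/(M+1) (m = 1,…,M), the expected average indicator discrepancy satisfies E[ (1/M) ∑_{m=1}^{M} |𝟙{U > τ'_m} − 𝟙{U > τ_m}| ] = (M−1)/(2M(M+1)), and this quantity tends to 0 as M → ∞. -/
open Filter MeasureTheory

lemma disc_eq (a b u : ℝ) (hab : a ≤ b) :
    |(if u > a then (1 : ℝ) else 0) - (if u > b then (1 : ℝ) else 0)|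
      = (Set.Ioc a b).indicator (fun _ => (1 : ℝ)) u := by
  by_cases h1 : u > a
  · by_cases h2 : u > b
    · have : u ∉ Set.Ioc a b := fun h => absurd h.2 (not_le.mpr h2)
      rw [Set.indicator_of_notMem this]
      simp [h1, h2]
    · have : u ∈ Set.Ioc a b := ⟨h1, not_lt.mp h2⟩
      rw [Set.indicator_of_mem this]
      simp [h1, h2]
  · have h2 : ¬ u > b := fun h => h1 (lt_of_le_of_lt hab h)
    have : u ∉ Set.Ioc a b := fun h => h1 h.1
    rw [Set.indicator_of_notMem this]
    simp [h1, h2]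

lemma disc_int (a b : ℝ) (h0 : 0 ≤ a) (hab : a ≤ b) (h1 : b ≤ 1) :
    ∫ u in Set.Icc (0 : ℝ) 1, (Set.Ioc a b).indicator (fun _ => (1 : ℝ)) u = b - a := by
  rw [setIntegral_indicator measurableSet_Ioc]
  have : Set.Icc (0 : ℝ) 1 ∩ Set.Ioc a b = Set.Ioc a b :=
    Set.inter_eq_right.mpr fun x hx => ⟨h0.trans hx.1.le, hx.2.trans h1⟩
  rw [this]
  simp [hab]

lemma sum_range_real (M : ℕ) :
    ∑ m ∈ Finset.range M, (m : ℝ) = (M : ℝ) * (M - 1) / 2 := by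
  induction M with
  | zero => simp
  | succ k ih => rw [Finset.sum_range_succ, ih]; push_cast; ring

/-- For `U` uniformly distributed on `[0,1]` and the threshold grids
`τ_m = (m-1)/M` and `τ'_m = (m-1)/(M+1)`, the expected average indicator
discrepancy equals `(M-1)/(2M(M+1))`, which tends to `0` as `M → ∞`. -/
theorem wintore_threshold_discrepancy :
    (∀ M : ℕ, 1 ≤ M →
      (∫ u in Set.Icc (0 : ℝ) 1,
        (1 / M : ℝ) * ∑ m ∈ Finset.range M,
          |(if u > (m : ℝ) / (M + 1) then (1 : ℝ) else 0)
            - (if u > (m : ℝ) / M then (1 : ℝ) else 0)|)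
        = ((M : ℝ) - 1) / (2 * M * (M + 1))) ∧
    Tendsto (fun M : ℕ => ((M : ℝ) - 1) / (2 * M * (M + 1))) atTop (nhds 0) := by
  constructor
  · intro M hM
    have hM0 : (0 : ℝ) < M := by exact_mod_cast hM
    have hle : ∀ m : ℕ, (m : ℝ) / (M + 1) ≤ (m : ℝ) / M := fun m =>
      div_le_div_of_nonneg_left (Nat.cast_nonneg m) hM0 (by linarith)
    simp_rw [disc_eq _ _ _ (hle _)]
    rw [integral_const_mul, integral_finsetSum]
    · have : ∀ m ∈ Finset.range M,
          (∫ u in Set.Icc (0 : ℝ) 1,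
            (Set.Ioc ((m : ℝ) / (M + 1)) ((m : ℝ) / M)).indicator (fun _ => (1 : ℝ)) u)
            = (m : ℝ) * (1 / (M * (M + 1))) := by
        intro m hm
        rw [disc_int _ _ (by positivity) (hle m)]
        · field_simp
          ring
        · rw [div_le_one hM0]
          exact_mod_cast (Finset.mem_range.mp hm).le
      rw [Finset.sum_congr rfl this, ← Finset.sum_mul, sum_range_real]
      field_simp
    · intro m _
      exact (integrable_const (1 : ℝ)).indicator measurableSet_Ioc
  · refine squeeze_zero' (g := fun M : ℕ => 1 / ((M : ℝ) + 1)) ?_ ?_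
      tendsto_one_div_add_atTop_nhds_zero_nat
    · filter_upwards [eventually_ge_atTop 1] with M hM
      have : (1 : ℝ) ≤ M := by exact_mod_cast hM
      exact div_nonneg (by linarith) (by positivity)
    · filter_upwards [eventually_ge_atTop 1] with M hM
      have : (1 : ℝ) ≤ M := by exact_mod_cast hM
      rw [div_le_div_iff₀ (by positivity) (by positivity)]
      nlinarith
end
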